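/- arXiv:1812.01953 — 2 statements merged into one kernel-verified Lean document; each statement's English description precedes it below -/
import Mathlib

section
/- If u ∈ C²(ℝⁿ) solves Δu = W'(u) on all of ℝⁿ, then u ≡ 0. -/
open MeasureTheory Set

open Filter Topology in
/-- Necessary first and second order conditions at a local minimum. -/
theorem aux_second (h h' : ℝ → ℝ) (c : ℝ)
    (hh : ∀ᶠ s in 𝓝 (0:ℝ), HasDerivAt h (h' s) s) (hc : HasDerivAt h' c 0)
    (hmin : IsLocalMin h 0) : h' 0 = 0 ∧ 0 ≤ c := by
  have h0 : h' 0 = 0 := hmin.hasDerivAt_eq_zero hh.self_of_nhds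
  refine ⟨h0, ?_⟩
  by_contra hneg
  push Not at hneg
  have hd : deriv h =ᶠ[𝓝 0] h' := hh.mono fun s hs => hs.deriv
  have hdd : deriv (deriv h) 0 = c := by rw [hd.deriv_eq, hc.deriv]
  have hmax : IsLocalMax h 0 :=
    isLocalMax_of_deriv_deriv_neg (by rw [hdd]; exact hneg)
      (by rw [hd.self_of_nhds, h0]) hh.self_of_nhds.continuousAt
  have hconst : h =ᶠ[𝓝 0] fun _ => h 0 := by
    filter_upwards [hmin, hmax] with s h1 h2 using le_antisymm h2 h1
  have h1 : deriv (deriv h) 0 = 0 := by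
    have := hconst.deriv
    rw [this.deriv_eq]; simp
  rw [hdd] at h1
  linarith

set_option maxHeartbeats 2000000 in
open Filter Topology in
theorem aux_nonpos
    (W : ℝ → ℝ) (hW : ContDiff ℝ 2 W) (hWnn : ∀ t, 0 ≤ W t)
    (hWconv : ConvexOn ℝ Set.univ W) (hWvan : ∀ t, W t = 0 ↔ t = 0)
    (hWint : IntegrableOn (fun u => 1 / Real.sqrt (W u)) (Ioi 1))
    (n : ℕ) (hn : 1 ≤ n)
    (u : EuclideanSpace ℝ (Fin n) → ℝ) (hu : ContDiff ℝ 2 u)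
    (hsol : ∀ x : EuclideanSpace ℝ (Fin n),
      (∑ i : Fin n, fderiv ℝ (fun y => fderiv ℝ u y (EuclideanSpace.single i 1)) x
          (EuclideanSpace.single i 1)) = deriv W (u x)) :
    ∀ x, u x ≤ 0 := by
  intro x0
  by_contra hpos
  push Not at hpos
  have hWd : ∀ t, HasDerivAt W (deriv W t) t := fun t =>
    (hW.differentiable (by norm_num) t).hasDerivAt
  have hWpos : ∀ t, 0 < t → 0 < W t := fun t ht =>
    lt_of_le_of_ne (hWnn t) fun h => ht.ne' ((hWvan t).1 h.symm)
  have hW0 : W 0 = 0 := (hWvan 0).2 rfl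
  have hWt : ∀ t, 0 < t → W t ≤ deriv W t * t := by
    intro t ht
    have := hWconv.slope_le_of_hasDerivAt (mem_univ 0) (mem_univ t) ht (hWd t)
    rw [slope_def_field, hW0, sub_zero, sub_zero, div_le_iff₀ ht] at this
    exact this
  have hWmono : MonotoneOn W (Ici 0) := by
    apply monotoneOn_of_deriv_nonneg (convex_Ici 0) hW.continuous.continuousOn
      (hW.differentiable (by norm_num)).differentiableOn
    intro t ht
    rw [interior_Ici] at ht
    have h1 := hWt t ht
    have h2 := hWpos t ht
    by_contra h3
    push Not at h3
    nlinarith [mul_neg_of_neg_of_pos h3 ht]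
  set δ := u x0 / 2 with hδ
  have hδ0 : 0 < δ := by positivity
  set g : ℝ → ℝ := fun t => 1 / Real.sqrt (W t) with hg
  have hgpos : ∀ t, 0 < t → 0 < g t := fun t ht => by
    have := Real.sqrt_pos.2 (hWpos t ht)
    simp only [hg]; positivity
  have hgnn : ∀ t, 0 ≤ g t := fun t => by simp only [hg]; positivity
  have hgc : ∀ t, 0 < t → ContinuousAt g t := fun t ht =>
    continuousAt_const.div (hW.continuous.continuousAt.sqrt) (Real.sqrt_pos.2 (hWpos t ht)).ne'
  have hgii : ∀ t, 0 < t → IntervalIntegrable g volume δ t := by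
    intro t ht
    apply ContinuousOn.intervalIntegrable
    intro s hs
    have : 0 < s := lt_of_lt_of_le (lt_min hδ0 ht) hs.1
    exact (hgc s this).continuousWithinAt
  have hgI : IntegrableOn g (Ioi δ) := by
    have h1 : IntegrableOn g (Icc δ 1) := by
      apply ContinuousOn.integrableOn_Icc
      intro s hs
      exact (hgc s (lt_of_lt_of_le hδ0 hs.1)).continuousWithinAt
    refine (h1.union hWint).mono_set ?_
    intro s hs
    by_cases h : s ≤ 1
    · left; exact ⟨le_of_lt hs, h⟩
    · right; exact not_le.1 h
  set C := ∫ t in Ioi δ, g t with hC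
  set P : ℝ → ℝ := fun t => ∫ s in δ..t, g s with hP
  have hPC : ∀ t, δ ≤ t → P t ≤ C := by
    intro t ht
    simp only [hP]
    rw [intervalIntegral.integral_of_le ht]
    exact setIntegral_mono_set hgI (Eventually.of_forall hgnn)
      (Eventually.of_forall fun s hs => hs.1)
  have hPd : ∀ t, 0 < t → HasDerivAt P (g t) t := by
    intro t ht
    apply intervalIntegral.integral_hasDerivAt_right (hgii t ht) _ (hgc t ht)
    have : ContinuousOn g (Ioi 0) := fun s hs => (hgc s hs).continuousWithinAt
    exact this.stronglyMeasurableAtFilter isOpen_Ioi t ht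
  have hPmono : StrictMonoOn P (Ioi 0) := by
    apply strictMonoOn_of_deriv_pos (convex_Ioi 0)
    · exact fun s hs => (hPd s hs).continuousAt.continuousWithinAt
    · intro s hs
      rw [interior_Ioi] at hs
      rw [(hPd s hs).deriv]; exact hgpos s hs
  -- lower bound for the integral
  have hPlow : ∀ t, δ ≤ t → (t - δ) * g t ≤ P t := by
    intro t ht
    have := intervalIntegral.integral_mono_on (f := fun _ => g t) (g := g) ht
      intervalIntegrable_const (hgii t (lt_of_lt_of_le hδ0 ht)) (by
        intro s hs
        have hs0 : 0 < s := lt_of_lt_of_le hδ0 hs.1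
        apply one_div_le_one_div_of_le (Real.sqrt_pos.2 (hWpos s hs0))
        exact Real.sqrt_le_sqrt (hWmono hs0.le (hs0.le.trans hs.2) hs.2))
    simpa using this
  have hux0 : u x0 = 2 * δ := by rw [hδ]; ring
  have hCpos : 0 < C := by
    have h1 := hPlow (2*δ) (by linarith)
    have h2 := hPC (2*δ) (by linarith)
    have h3 := mul_pos hδ0 (hgpos (2*δ) (by linarith))
    nlinarith
  have hP0 : 0 < P (u x0) := by
    have := hPmono (mem_Ioi.2 hδ0) (mem_Ioi.2 hpos) (by linarith)
    simpa [hP] using this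
  have hn' : (1:ℝ) ≤ n := by exact_mod_cast hn
  obtain ⟨c, hc, hcC⟩ : ∃ c : ℝ, 0 < c ∧ 16 * n * C * c = 1 :=
    ⟨1 / (16 * n * C), by positivity, by field_simp⟩
  set f : EuclideanSpace ℝ (Fin n) → ℝ := fun x => - P (u x) + c * ‖x - x0‖ ^ 2 with hf
  obtain ⟨R, hR, hRC⟩ : ∃ R : ℝ, 0 < R ∧ c * R ^ 2 = C :=
    ⟨Real.sqrt (C / c), by positivity, by rw [Real.sq_sqrt (by positivity)]; field_simp⟩
  set K := Metric.closedBall x0 R ∩ {x | δ ≤ u x} with hK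
  have hKc : IsCompact K :=
    (isCompact_closedBall x0 R).inter_right (isClosed_le continuous_const hu.continuous)
  have hx0K : x0 ∈ K := ⟨Metric.mem_closedBall_self hR.le, by show δ ≤ u x0; linarith⟩
  have hfc : ContinuousOn f K := by
    intro x hx
    have hx' : 0 < u x := lt_of_lt_of_le hδ0 hx.2
    have h1 : ContinuousAt (fun x => P (u x)) x :=
      ContinuousAt.comp (hPd _ hx').continuousAt hu.continuous.continuousAt
    have h2 : Continuous fun x : EuclideanSpace ℝ (Fin n) => c * ‖x - x0‖ ^ 2 := by fun_prop
    exact (h1.neg.add h2.continuousAt).continuousWithinAt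
  obtain ⟨y, hyK, hymin⟩ := hKc.exists_isMinOn ⟨x0, hx0K⟩ hfc
  have hfy : f y ≤ - P (u x0) := by
    have h1 : f y ≤ f x0 := hymin hx0K
    have h2 : f x0 = - P (u x0) := by simp [hf]
    rwa [h2] at h1
  have hyδ : δ ≤ u y := hyK.2
  have huy0 : 0 < u y := lt_of_lt_of_le hδ0 hyδ
  have huy : u x0 ≤ u y := by
    by_contra h
    push Not at h
    have := hPmono (mem_Ioi.2 huy0) (mem_Ioi.2 hpos) h
    have h2 : 0 ≤ c * ‖y - x0‖^2 := by positivity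
    simp only [hf] at hfy
    linarith
  have hyC : c * ‖y - x0‖ ^ 2 < C := by
    have := hPC _ hyδ
    simp only [hf] at hfy
    linarith
  have hyR : ‖y - x0‖ < R := by
    rw [← hRC] at hyC
    exact lt_of_pow_lt_pow_left₀ 2 hR.le (lt_of_mul_lt_mul_left hyC hc.le)
  have hlm : IsLocalMin f y := by
    have h1 : ∀ᶠ z in 𝓝 y, z ∈ Metric.ball x0 R :=
      Metric.isOpen_ball.mem_nhds (by rwa [Metric.mem_ball, dist_eq_norm])
    have h2 : ∀ᶠ z in 𝓝 y, δ < u z :=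
      hu.continuous.continuousAt.eventually (lt_mem_nhds (by linarith))
    filter_upwards [h1, h2] with z hz1 hz2
    exact hymin ⟨Metric.ball_subset_closedBall hz1, hz2.le⟩
  -- computations along coordinate directions
  set q := Real.sqrt (W (u y)) with hq
  have hq0 : 0 < q := Real.sqrt_pos.2 (hWpos _ huy0)
  have hqq : q ^ 2 = W (u y) := Real.sq_sqrt (hWnn _)
  set D := deriv W (u y) with hD
  have key : ∀ i : Fin n,
      0 ≤ -(fderiv ℝ (fun y => fderiv ℝ u y (EuclideanSpace.single i 1)) y
          (EuclideanSpace.single i 1)) / q + 2 * c ^ 2 * ((y - x0) i) ^ 2 * D / q + 2 * c := by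
    intro i
    set e : EuclideanSpace ℝ (Fin n) := EuclideanSpace.single i 1 with he
    set A := fderiv ℝ (fun y => fderiv ℝ u y e) y e with hA
    have hline : ∀ s : ℝ, HasDerivAt (fun s : ℝ => y + s • e) e s := by
      intro s
      simpa using ((hasDerivAt_id s).smul_const e).const_add y
    have hp : ∀ s : ℝ, HasDerivAt (fun s : ℝ => u (y + s • e)) (fderiv ℝ u (y + s • e) e) s := by
      intro s
      exact ((hu.differentiable (by norm_num) _).hasFDerivAt).comp_hasDerivAt s (hline s)
    have hp2 : HasDerivAt (fun s : ℝ => fderiv ℝ u (y + s • e) e) A 0 := by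
      have hd : Differentiable ℝ (fun y => fderiv ℝ u y e) := by
        have : ContDiff ℝ 1 (fderiv ℝ u) := hu.fderiv_right (by norm_num)
        exact (this.differentiable (by norm_num)).clm_apply (differentiable_const e)
      have h0 : y + (0:ℝ) • e = y := by simp
      have := (hd (y + (0:ℝ) • e)).hasFDerivAt.comp_hasDerivAt 0 (hline 0)
      rw [h0] at this
      exact this
    have hN : ∀ s : ℝ, ‖y + s • e - x0‖ ^ 2 = ‖y - x0‖ ^ 2 + 2 * s * (y - x0) i + s ^ 2 := by
      intro s
      rw [show y + s • e - x0 = (y - x0) + s • e by abel, norm_add_sq_real, inner_smul_right,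
        norm_smul]
      have h1 : inner ℝ (y - x0) e = (y - x0) i := by
        rw [he, EuclideanSpace.inner_single_right]; simp
      have h2 : ‖e‖ = 1 := by rw [he]; simp
      rw [h1, h2]; simp; ring
    have hev : ∀ᶠ s in 𝓝 (0:ℝ), 0 < u (y + s • e) := by
      have : ContinuousAt (fun s : ℝ => u (y + s • e)) 0 := (hp 0).continuousAt
      apply this.eventually (lt_mem_nhds _)
      simpa using huy0
    have hh1 : ∀ᶠ s in 𝓝 (0:ℝ), HasDerivAt (fun s : ℝ => f (y + s • e))
        (-(g (u (y + s • e)) * fderiv ℝ u (y + s • e) e) + c * (2 * (y - x0) i + 2 * s)) s := by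
      filter_upwards [hev] with s hs
      have h1 := ((hPd _ hs).comp s (hp s)).neg
      have h2 : HasDerivAt (fun s : ℝ => c * ‖y + s • e - x0‖ ^ 2)
          (c * (2 * (y - x0) i + 2 * s)) s := by
        simp only [hN]
        have h3 : HasDerivAt (fun s : ℝ => ‖y - x0‖ ^ 2 + 2 * s * (y - x0) i + s ^ 2)
            (2 * (y - x0) i + 2 * s) s := by
          have := ((((hasDerivAt_id s).const_mul 2).mul_const ((y - x0) i)).const_add
            (‖y - x0‖ ^ 2)).add ((hasDerivAt_id s).pow 2)
          exact this.congr_deriv (by simp)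
        exact h3.const_mul c
      exact h1.add h2
    have hg' : HasDerivAt g (-(D / (2 * q)) / q ^ 2) (u (y + (0:ℝ) • e)) := by
      have h0 : y + (0:ℝ) • e = y := by simp
      rw [h0]
      have h1 : HasDerivAt (fun t => Real.sqrt (W t)) (D / (2 * q)) (u y) :=
        (hWd (u y)).sqrt (hWpos _ huy0).ne'
      have h2 := h1.inv hq0.ne'
      simp only [hg, one_div]
      exact h2
    have hh2 := (((hg'.comp 0 (hp 0)).mul hp2).neg).add
      ((((hasDerivAt_id (0:ℝ)).const_mul 2).const_add (2 * (y - x0) i)).const_mul c)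
    have hlm' : IsLocalMin (fun s : ℝ => f (y + s • e)) 0 := by
      have : ContinuousAt (fun s : ℝ => y + s • e) 0 := (hline 0).continuousAt
      have h0 : y + (0:ℝ) • e = y := by simp
      have h3 : Tendsto (fun s : ℝ => y + s • e) (𝓝 0) (𝓝 y) := by
        simpa [ContinuousAt] using this
      have := h3.eventually hlm
      filter_upwards [this] with s hs
      simpa using hs
    obtain ⟨r1, r2⟩ := aux_second _ _ _ hh1 hh2 hlm'
    simp only [zero_smul, add_zero, mul_zero, Function.comp] at r1 r2
    set B := fderiv ℝ u y e with hB
    have hgq : g (u y) = 1 / q := rfl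
    rw [hgq] at r1 r2
    have hBq : B = 2 * c * (y - x0) i * q := by
      field_simp at r1
      linarith
    rw [hBq] at r2
    refine r2.trans (le_of_eq ?_)
    field_simp
    ring
  have hsum := Finset.sum_nonneg fun i (_ : i ∈ Finset.univ) => key i
  rw [Finset.sum_add_distrib, Finset.sum_add_distrib, ← Finset.sum_div, ← Finset.sum_div,
    Finset.sum_neg_distrib, hsol y, ← Finset.sum_mul, ← Finset.mul_sum] at hsum
  have hnorm : ∑ i, ((y - x0) i) ^ 2 = ‖y - x0‖ ^ 2 := by
    rw [EuclideanSpace.norm_sq_eq]; simp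
  rw [hnorm] at hsum
  simp only [Finset.sum_const, Finset.card_univ, Fintype.card_fin, nsmul_eq_mul] at hsum
  -- lower bound of D / q
  have hDq : 1 / (2 * C) ≤ D / q := by
    have h1 := (hPlow _ hyδ).trans (hPC _ hyδ)
    have hgq : g (u y) = 1 / q := rfl
    rw [hgq, mul_one_div, div_le_iff₀ hq0] at h1
    have h2 := hWt _ huy0
    rw [← hqq] at h2
    rw [div_le_div_iff₀ (by positivity) hq0]
    have h3 : u y ≤ 2 * C * q := by linarith
    have hDnn : 0 ≤ D := by
      by_contra h
      push Not at h
      nlinarith [mul_neg_of_neg_of_pos h huy0, sq_nonneg q, pow_pos hq0 2]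
    have h4 : q * q ≤ D * (2 * C) * q := by nlinarith
    have := le_of_mul_le_mul_right h4 hq0
    linarith
  set m := D / q with hm
  have hsum' : 0 ≤ m * (2 * c * (c * ‖y - x0‖ ^ 2) - 1) + 2 * c * n := by
    refine hsum.trans (le_of_eq ?_)
    rw [hm]; field_simp; ring
  have hcC' : 16 * (c * C) ≤ 1 := by nlinarith [mul_pos hc hCpos]
  have h5 : 2 * c * (c * ‖y - x0‖ ^ 2) - 1 ≤ -(1/2) := by nlinarith
  have hm0 : 0 < 1 / (2 * C) := by positivity
  have h6 : 2 * c * n = 1 / (8 * C) := by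
    field_simp; linarith
  have h7 : 1 / (8 * C) = 1 / (2 * C) / 4 := by field_simp; norm_num
  nlinarith

theorem entire_solution_is_zero
    (W : ℝ → ℝ) (hW : ContDiff ℝ 2 W) (hWnn : ∀ t, 0 ≤ W t)
    (hWconv : ConvexOn ℝ Set.univ W) (hWvan : ∀ t, W t = 0 ↔ t = 0)
    (hWint : IntegrableOn (fun u => 1 / Real.sqrt (W u)) {u : ℝ | 1 < |u|})
    (n : ℕ) (hn : 1 ≤ n)
    (u : EuclideanSpace ℝ (Fin n) → ℝ) (hu : ContDiff ℝ 2 u)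
    (hsol : ∀ x : EuclideanSpace ℝ (Fin n),
      (∑ i : Fin n, fderiv ℝ (fun y => fderiv ℝ u y (EuclideanSpace.single i 1)) x
          (EuclideanSpace.single i 1)) = deriv W (u x)) :
    ∀ x, u x = 0 := by
  intro x
  apply le_antisymm
  · refine aux_nonpos W hW hWnn hWconv hWvan (hWint.mono_set ?_) n hn u hu hsol x
    intro s hs
    exact lt_of_lt_of_le hs (le_abs_self s)
  · have := aux_nonpos (fun t => W (-t)) (hW.comp contDiff_neg) (fun t => hWnn _) ?_
      (fun t => by rw [hWvan, neg_eq_zero]) ?_ n hn (fun x => - u x) hu.neg ?_ x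
    · linarith
    · refine ⟨convex_univ, fun a _ b _ p q hp hq hpq => ?_⟩
      have := hWconv.2 (mem_univ (-a)) (mem_univ (-b)) hp hq hpq
      simp only [smul_eq_mul] at this ⊢
      convert this using 2
      ring
    · have h1 : IntegrableOn (fun u => 1 / Real.sqrt (W u)) (Iio (-1)) :=
        hWint.mono_set fun s hs => by
          have : s < -1 := hs
          exact lt_of_lt_of_le (by linarith) (neg_le_abs s)
      have := h1.comp_neg
      simpa using this
    · intro x
      have h1 : deriv (fun t => W (-t)) (-u x) = - deriv W (u x) := by
        rw [deriv_comp_neg]; simp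
      rw [h1, ← hsol x, ← Finset.sum_neg_distrib]
      refine Finset.sum_congr rfl fun i _ => ?_
      simp only [fderiv_fun_neg, neg_apply]
end

section
/- Let Ω ⊂ ℝⁿ be open with the function x ↦ d(x, ∂Ω) unbounded on Ω. Then every C² solution v of Δv = W'(v) in Ω satisfies v(x) → 0 as d(x, ∂Ω) → ∞ (x ∈ Ω). More precisely, d(x, ∂Ω) > l(λ) implies v(x) ≤ λ for every λ > 0 and v(x) ≥ λ for every λ < 0, where l(λ) is the blow-up half-length of the radial super/subsolution built from potential W/n. -/
open MeasureTheory Set Filter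

/-- Second order necessary condition at a local maximum. -/
lemma aux_second_order (g g1 : ℝ → ℝ) (g2 : ℝ)
    (h1 : ∀ᶠ t in nhds (0:ℝ), HasDerivAt g (g1 t) t) (h2 : HasDerivAt g1 g2 0)
    (hm : IsLocalMax g 0) : g1 0 = 0 ∧ g2 ≤ 0 := by
  have hz : g1 0 = 0 := hm.hasDerivAt_eq_zero h1.self_of_nhds
  refine ⟨hz, ?_⟩
  by_contra hpos
  push Not at hpos
  have hd : deriv g =ᶠ[nhds 0] g1 := h1.mono fun t ht => ht.deriv
  have hdd : deriv (deriv g) 0 = g2 := by rw [hd.deriv_eq]; exact h2.deriv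
  have hmin : IsLocalMin g 0 :=
    isLocalMin_of_deriv_deriv_pos (by rw [hdd]; exact hpos) (by rw [hd.self_of_nhds, hz])
      h1.self_of_nhds.continuousAt
  have hc : g =ᶠ[nhds 0] fun _ => g 0 := by
    filter_upwards [hm, hmin] with t a b
    exact le_antisymm a b
  have h0 : deriv g =ᶠ[nhds 0] fun _ => 0 := by
    have := hc.deriv
    filter_upwards [this] with t ht
    simpa using ht
  have : deriv (deriv g) 0 = 0 := by rw [h0.deriv_eq]; simp
  linarith

/-- Convexity lower bound. -/
lemma aux_convex (W : ℝ → ℝ) (hWconv : ConvexOn ℝ Set.univ W) (h0 : W 0 = 0)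
    (lam : ℝ) (hl : 0 < lam) (s : ℝ) (hs : 0 ≤ s) :
    W lam + s * (W lam / lam) ≤ W (s + lam) := by
  have hp : 0 < s + lam := by linarith
  have h := hWconv.2 (mem_univ (0:ℝ)) (mem_univ (s + lam))
    (show 0 ≤ s / (s + lam) by positivity) (show 0 ≤ lam / (s + lam) by positivity)
    (by field_simp)
  simp only [smul_eq_mul, mul_zero, zero_add, h0] at h
  rw [div_mul_cancel₀ _ hp.ne'] at h
  have : W lam * ((s + lam) / lam) ≤ W (s + lam) := by
    calc _ ≤ (lam / (s + lam) * W (s + lam)) * ((s + lam) / lam) := by gcongr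
      _ = W (s + lam) := by field_simp
  calc _ = W lam * ((s + lam) / lam) := by field_simp; ring
    _ ≤ _ := this

lemma aux_integrable (W : ℝ → ℝ) (hW : Continuous W) (hWnn : ∀ t, 0 ≤ W t)
    (hWconv : ConvexOn ℝ Set.univ W) (hWvan : ∀ t, W t = 0 ↔ t = 0)
    (hWint : IntegrableOn (fun u => 1 / Real.sqrt (W u)) {u : ℝ | 1 < |u|})
    (n : ℕ) (hn : 1 ≤ n) (lam : ℝ) (hl : 0 < lam) :
    IntegrableOn (fun s => 1 / Real.sqrt (2 * (W (s + lam) / n - W lam / n))) (Ioi 0) := by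
  have hN : (0:ℝ) < n := by exact_mod_cast hn
  have hWl : 0 < W lam := lt_of_le_of_ne (hWnn _) (fun h => hl.ne' ((hWvan _).1 h.symm))
  have hconv := aux_convex W hWconv ((hWvan 0).2 rfl) lam hl
  have hmeas : Measurable (fun s => 1 / Real.sqrt (2 * (W (s + lam) / n - W lam / n))) := by
    have := hW.measurable
    fun_prop
  set S := max 1 lam with hS
  have hS1 : 1 ≤ S := le_max_left _ _
  have hSl : lam ≤ S := le_max_right _ _
  rw [← Ioc_union_Ioi_eq_Ioi (show (0:ℝ) ≤ S by linarith)]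
  refine IntegrableOn.union ?_ ?_
  · set k := 2 * (W lam / lam / n) with hk
    have hkp : 0 < k := by positivity
    have hi : IntegrableOn (fun s : ℝ => 1 / Real.sqrt k * s ^ (-(1/2) : ℝ)) (Ioc 0 S) := by
      have := intervalIntegral.intervalIntegrable_rpow' (a := 0) (b := S) (r := (-(1/2) : ℝ))
        (by norm_num)
      rw [intervalIntegrable_iff_integrableOn_Ioc_of_le (by linarith)] at this
      exact this.const_mul _
    refine Integrable.mono' hi hmeas.aestronglyMeasurable ?_
    refine (ae_restrict_iff' measurableSet_Ioc).2 (ae_of_all _ fun s hs => ?_)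
    have hs0 : 0 < s := hs.1
    rw [Real.norm_of_nonneg (by positivity), Real.rpow_neg hs0.le, ← Real.sqrt_eq_rpow,
      one_div, one_div, ← mul_inv, ← Real.sqrt_mul hkp.le]
    have : k * s ≤ 2 * (W (s + lam) / n - W lam / n) := by
      have := hconv s hs0.le
      rw [hk, ← sub_div]
      calc _ = 2 * ((s * (W lam / lam)) / n) := by ring
        _ ≤ _ := by gcongr; linarith
    have h2 : 0 < Real.sqrt (k * s) := Real.sqrt_pos.2 (by positivity)
    exact inv_anti₀ h2 (Real.sqrt_le_sqrt this)
  · have hi : IntegrableOn (fun s : ℝ => Real.sqrt n * (1 / Real.sqrt (W (s + lam)))) (Ioi S) := by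
      have h1 : IntegrableOn (fun u => 1 / Real.sqrt (W u)) (Ioi (S + lam)) :=
        hWint.mono_set fun u hu => by
          have : S + lam < u := hu
          show 1 < |u|
          exact lt_of_lt_of_le (by linarith) (le_abs_self u)
      have h2 := ((measurePreserving_add_right volume lam).integrableOn_comp_preimage
        (measurableEmbedding_addRight lam)).2 h1
      have he : (fun x : ℝ => x + lam) ⁻¹' Ioi (S + lam) = Ioi S := by
        ext u; simp
      rw [he] at h2
      exact h2.const_mul _
    refine Integrable.mono' hi hmeas.aestronglyMeasurable ?_
    refine (ae_restrict_iff' measurableSet_Ioi).2 (ae_of_all _ fun s hs => ?_)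
    have hs0 : S < s := hs
    have hsp : 0 < s := by linarith
    have hc := hconv s hsp.le
    have hge : W lam ≤ s * (W lam / lam) := by
      calc W lam = lam * (W lam / lam) := by field_simp
        _ ≤ _ := by gcongr; linarith
    have hWs : 0 < W (s + lam) := by linarith
    rw [Real.norm_of_nonneg (by positivity)]
    have h3 : W (s + lam) / n ≤ 2 * (W (s + lam) / n - W lam / n) := by
      rw [← sub_div, ← mul_div_assoc]; gcongr; linarith
    calc 1 / Real.sqrt (2 * (W (s + lam) / n - W lam / n)) ≤ 1 / Real.sqrt (W (s + lam) / n) := by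
          apply one_div_le_one_div_of_le (Real.sqrt_pos.2 (by positivity))
          exact Real.sqrt_le_sqrt h3
      _ = _ := by rw [Real.sqrt_div hWs.le]; field_simp

/-- The time function `G`: its properties. -/
lemma aux_G (W : ℝ → ℝ) (hW : ContDiff ℝ 2 W) (hWnn : ∀ t, 0 ≤ W t)
    (hWconv : ConvexOn ℝ Set.univ W) (hWvan : ∀ t, W t = 0 ↔ t = 0)
    (hWint : IntegrableOn (fun u => 1 / Real.sqrt (W u)) {u : ℝ | 1 < |u|})
    (n : ℕ) (hn : 1 ≤ n) (lam : ℝ) (hl : 0 < lam) :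
    ∃ G S : ℝ → ℝ, Continuous G ∧ (∀ a ≤ lam, G a = 0) ∧ (∀ a, lam < a → 0 < G a) ∧
      (∀ a, G a ≤ ∫ s in Ioi (0:ℝ), 1 / Real.sqrt (2 * (W (s + lam) / n - W lam / n))) ∧
      (∀ a, 0 ≤ G a) ∧
      (∀ a, lam < a → 0 < S a) ∧
      (∀ a, lam < a → HasDerivAt G (1 / S a) a) ∧
      (∀ a, lam < a → HasDerivAt S (deriv W a / (n * S a)) a) ∧
      (∀ a, lam < a → S a ≤ G a * (deriv W a / n)) := by
  have hN : (0:ℝ) < n := by exact_mod_cast hn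
  have hint := aux_integrable W hW.continuous hWnn hWconv hWvan hWint n hn lam hl
  have hconv := aux_convex W hWconv ((hWvan 0).2 rfl) lam hl
  have hWl : 0 < W lam := lt_of_le_of_ne (hWnn _) (fun h => hl.ne' ((hWvan _).1 h.symm))
  have hWlt : ∀ a, lam < a → W lam < W a := fun a ha => by
    have := hconv (a - lam) (by linarith)
    rw [sub_add_cancel] at this
    have : 0 < (a - lam) * (W lam / lam) := mul_pos (by linarith) (by positivity)
    linarith
  set f : ℝ → ℝ := fun s => 1 / Real.sqrt (2 * (W (s + lam) / n - W lam / n)) with hf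
  have hf0 : ∀ s, 0 ≤ f s := fun s => by positivity
  have hWc := hW.continuous
  set S : ℝ → ℝ := fun a => Real.sqrt (2 * (W a / n - W lam / n)) with hS
  have hSc : Continuous S := by fun_prop
  have hpos : ∀ a, lam < a → 0 < 2 * (W a / n - W lam / n) := fun a ha => by
    have := hWlt a ha
    rw [← sub_div]
    have : 0 < W a - W lam := by linarith
    positivity
  have hSp : ∀ a, lam < a → 0 < S a := fun a ha => Real.sqrt_pos.2 (hpos a ha)
  have hi : ∀ b, IntervalIntegrable (indicator (Ioi 0) f) volume 0 b := fun b =>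
    (hint.integrable_indicator measurableSet_Ioi).intervalIntegrable
  set G : ℝ → ℝ := fun a => ∫ s in (0:ℝ)..(a - lam), indicator (Ioi 0) f s with hG
  have hGc : Continuous G := by
    have : Continuous fun b => ∫ s in (0:ℝ)..b, indicator (Ioi 0) f s :=
      intervalIntegral.continuous_primitive
        (fun a b => (hint.integrable_indicator measurableSet_Ioi).intervalIntegrable) 0
    exact this.comp (continuous_id.sub continuous_const)
  have hG0 : ∀ a ≤ lam, G a = 0 := fun a ha => by
    simp only [hG]
    rw [intervalIntegral.integral_symm, intervalIntegral.integral_of_le (by linarith),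
      neg_eq_zero]
    refine setIntegral_eq_zero_of_forall_eq_zero fun s hs => ?_
    exact indicator_of_notMem (fun h => not_lt.2 hs.2 h) _
  have hGd : ∀ a, lam < a → HasDerivAt G (1 / S a) a := fun a ha => by
    have hfa : ContinuousAt (indicator (Ioi 0) f) (a - lam) := by
      have h1 : indicator (Ioi 0) f =ᶠ[nhds (a - lam)] f := by
        filter_upwards [Ioi_mem_nhds (show 0 < a - lam by linarith)] with s hs
        exact indicator_of_mem hs _
      refine ContinuousAt.congr ?_ h1.symm
      have : ContinuousAt (fun s => S (s + lam)) (a - lam) := by fun_prop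
      refine ContinuousAt.div continuousAt_const this ?_
      rw [sub_add_cancel]
      exact (hSp a ha).ne'
    have h := intervalIntegral.integral_hasDerivAt_right (hi (a - lam))
      (((hint.integrable_indicator measurableSet_Ioi).aestronglyMeasurable).stronglyMeasurableAtFilter) hfa
    have h2 := HasDerivAt.comp a h ((hasDerivAt_id a).sub_const lam)
    have e : indicator (Ioi 0) f (a - lam) = 1 / S a := by
      rw [indicator_of_mem (show a - lam ∈ Ioi 0 from by simpa using ha)]
      simp [hf, hS]
    rw [e, mul_one] at h2
    exact h2
  have hSd : ∀ a, lam < a → HasDerivAt S (deriv W a / (n * S a)) a := fun a ha => by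
    have hd : HasDerivAt W (deriv W a) a :=
      (hW.differentiable (by norm_num)).differentiableAt.hasDerivAt
    have := (((hd.div_const (n:ℝ)).sub_const (W lam / n)).const_mul 2).sqrt (hpos a ha).ne'
    convert this using 1
    have := (hSp a ha).ne'
    simp only [hS] at this ⊢
    field_simp
  have hGm : ∀ a, lam < a → 0 < G a := fun a ha => by
    have : StrictMonoOn G (Icc lam a) := by
      refine strictMonoOn_of_deriv_pos (convex_Icc _ _) hGc.continuousOn fun x hx => ?_
      rw [interior_Icc] at hx
      rw [(hGd x hx.1).deriv]
      have := hSp x hx.1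
      positivity
    have := this (left_mem_Icc.2 ha.le) (right_mem_Icc.2 ha.le) ha
    rwa [hG0 lam le_rfl] at this
  have hGnn : ∀ a, 0 ≤ G a := fun a => by
    rcases le_or_gt a lam with h | h
    · rw [hG0 a h]
    · exact (hGm a h).le
  refine ⟨G, S, hGc, hG0, hGm, ?_, hGnn, hSp, hGd, hSd, ?_⟩
  · intro a
    rcases le_or_gt a lam with h | h
    · rw [hG0 a h]
      exact integral_nonneg fun s => hf0 s
    · simp only [hG]
      rw [intervalIntegral.integral_of_le (by linarith), ← integral_indicator measurableSet_Ioi]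
      exact setIntegral_le_integral (hint.integrable_indicator measurableSet_Ioi)
        (ae_of_all _ fun s => indicator_nonneg (fun s _ => hf0 s) s)
  · intro a ha
    have hmono : Monotone (deriv W) := by
      have := hWconv.monotoneOn_deriv
        (fun x _ => (hW.differentiable (by norm_num)).differentiableAt)
      rwa [monotoneOn_univ] at this
    have hM : MonotoneOn (fun u => G u * (deriv W a / n) - S u) (Icc lam a) := by
      have hder : ∀ x ∈ Ioo lam a, HasDerivAt (fun u => G u * (deriv W a / n) - S u)
          (1 / S x * (deriv W a / n) - deriv W x / (n * S x)) x := fun x hx =>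
        ((hGd x hx.1).mul_const _).sub (hSd x hx.1)
      refine monotoneOn_of_deriv_nonneg (convex_Icc _ _) (by fun_prop) ?_ fun x hx => ?_
      · rw [interior_Icc]
        exact fun x hx => (hder x hx).differentiableAt.differentiableWithinAt
      rw [interior_Icc] at hx
      rw [(hder x hx).deriv]
      have h1 := hSp x hx.1
      have h2 := hmono hx.2.le
      have : 1 / S x * (deriv W a / n) - deriv W x / (n * S x)
        = (deriv W a - deriv W x) / (n * S x) := by field_simp
      rw [this]
      exact div_nonneg (by linarith) (by positivity)
    have := hM (left_mem_Icc.2 ha.le) (right_mem_Icc.2 ha.le) ha.le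
    have hSl : S lam = 0 := by simp [hS]
    simp only [hG0 lam le_rfl, hSl] at this
    linarith

lemma aux_ball {n : ℕ} (Ω : Set (EuclideanSpace ℝ (Fin n))) (hΩ : IsOpen Ω)
    (x : EuclideanSpace ℝ (Fin n)) (hx : x ∈ Ω) (R : ℝ) (hR : 0 ≤ R)
    (h : R < Metric.infDist x (frontier Ω)) : Metric.closedBall x R ⊆ Ω := by
  have hd : Disjoint (Metric.closedBall x R) (frontier Ω) := by
    rw [Set.disjoint_left]
    intro y hy hf
    have := Metric.infDist_le_dist_of_mem (x := x) hf
    rw [Metric.mem_closedBall, dist_comm] at hy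
    linarith
  have hc : IsPreconnected (Metric.closedBall x R) := (convex_closedBall x R).isPreconnected
  intro y hy
  by_contra hyn
  have hyc : y ∉ closure Ω := fun hcl => by
    refine Set.disjoint_left.1 hd hy ?_
    rw [hΩ.frontier_eq]
    exact ⟨hcl, hyn⟩
  obtain ⟨z, hz, hz1, hz2⟩ := hc Ω (closure Ω)ᶜ hΩ isClosed_closure.isOpen_compl
    (fun z hz => by
      by_cases h1 : z ∈ Ω
      · exact Or.inl h1
      · refine Or.inr fun hcl => Set.disjoint_left.1 hd hz ?_
        rw [hΩ.frontier_eq]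
        exact ⟨hcl, h1⟩)
    ⟨x, Metric.mem_closedBall_self hR, hx⟩ ⟨y, hy, hyc⟩
  exact hz2 (subset_closure hz1)

lemma aux_core
    (W : ℝ → ℝ) (hW : ContDiff ℝ 2 W) (hWnn : ∀ t, 0 ≤ W t)
    (hWconv : ConvexOn ℝ Set.univ W) (hWvan : ∀ t, W t = 0 ↔ t = 0)
    (hWint : IntegrableOn (fun u => 1 / Real.sqrt (W u)) {u : ℝ | 1 < |u|})
    (n : ℕ) (hn : 1 ≤ n)
    (Ω : Set (EuclideanSpace ℝ (Fin n))) (hΩopen : IsOpen Ω)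
    (v : EuclideanSpace ℝ (Fin n) → ℝ) (hv : ContDiffOn ℝ 2 v Ω)
    (hsol : ∀ x ∈ Ω,
      (∑ i : Fin n, fderiv ℝ (fun y => fderiv ℝ v y (EuclideanSpace.single i 1)) x
          (EuclideanSpace.single i 1)) = deriv W (v x))
    (lam : ℝ) (hl : 0 < lam) (x : EuclideanSpace ℝ (Fin n)) (hx : x ∈ Ω)
    (hd : (∫ s in Ioi (0:ℝ), 1 / Real.sqrt (2 * (W (s + lam) / n - W lam / n)))
        < Metric.infDist x (frontier Ω)) : v x ≤ lam := by
  have hN : (1:ℝ) ≤ n := by exact_mod_cast hn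
  obtain ⟨G, S, hGc, hG0, hGp, hGl, hGnn, hSp, hGd, hSd, hSG⟩ :=
    aux_G W hW hWnn hWconv hWvan hWint n hn lam hl
  set l := ∫ s in Ioi (0:ℝ), 1 / Real.sqrt (2 * (W (s + lam) / n - W lam / n)) with hldef
  by_contra hlt
  push Not at hlt
  have hl0 : 0 ≤ l := (hGnn 0).trans (hGl 0)
  obtain ⟨R, hlR, hRd⟩ := exists_between hd
  have hRp : 0 < R := by linarith
  obtain ⟨c, hc0, hc1, hcR⟩ : ∃ c : ℝ, 0 < c ∧ c < 1 ∧ l ^ 2 < c * R ^ 2 := by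
    have : l ^ 2 / R ^ 2 < 1 := by
      rw [div_lt_one (by positivity)]; gcongr
    obtain ⟨c, h1, h2⟩ := exists_between this
    refine ⟨c, lt_of_le_of_lt (by positivity) h1, h2, ?_⟩
    rwa [div_lt_iff₀ (by positivity)] at h1
  have hball := aux_ball Ω hΩopen x hx R hRp.le hRd
  obtain ⟨y, hy, hmax⟩ := (isCompact_closedBall x R).exists_isMaxOn
    ⟨x, Metric.mem_closedBall_self hRp.le⟩
    (f := fun z => G (v z) ^ 2 - c * ‖z - x‖ ^ 2)
    (((hGc.comp_continuousOn (hv.continuousOn.mono hball)).pow 2).sub (by fun_prop))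
  have hyx : G (v x) ^ 2 ≤ G (v y) ^ 2 - c * ‖y - x‖ ^ 2 := by
    have := hmax (Metric.mem_closedBall_self hRp.le)
    simpa using this
  have hGx := hGp _ hlt
  have hGy : c * ‖y - x‖ ^ 2 < G (v y) ^ 2 := by
    have : 0 < G (v x) ^ 2 := by positivity
    linarith
  have hvy : lam < v y := by
    by_contra hle
    rw [hG0 _ (not_lt.1 hle)] at hGy
    have : 0 ≤ c * ‖y - x‖ ^ 2 := by positivity
    norm_num at hGy
    linarith
  have hyR : ‖y - x‖ < R := by
    by_contra hle
    push Not at hle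
    have h1 : c * R ^ 2 ≤ c * ‖y - x‖ ^ 2 := by gcongr
    have h2 : G (v y) ^ 2 ≤ l ^ 2 := by
      have := hGnn (v y)
      have := hGl (v y)
      gcongr
    linarith
  have hyΩ : y ∈ Ω := hball hy
  have hloc : IsLocalMax (fun z => G (v z) ^ 2 - c * ‖z - x‖ ^ 2) y := by
    refine hmax.isLocalMax ?_
    refine Filter.mem_of_superset (Metric.isOpen_ball.mem_nhds ?_) Metric.ball_subset_closedBall
    rwa [Metric.mem_ball, dist_eq_norm]
  set w := y - x with hw
  have hvd : ∀ z ∈ Ω, HasFDerivAt v (fderiv ℝ v z) z := fun z hz =>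
    ((hv.contDiffAt (hΩopen.mem_nhds hz)).differentiableAt (by norm_num)).hasFDerivAt
  have hvdd : DifferentiableAt ℝ (fderiv ℝ v) y :=
    ((hv.contDiffAt (hΩopen.mem_nhds hyΩ)).fderiv_right (m := 1) (by norm_num)).differentiableAt
      (by norm_num)
  set g := G (v y) with hg
  set σ := S (v y) with hσ
  set T := deriv W (v y) with hT
  have hgp : 0 < g := hGp _ hvy
  have hσp : 0 < σ := hSp _ hvy
  have key : ∀ i : Fin n,
      2 * g / σ * fderiv ℝ v y (EuclideanSpace.single i 1) = 2 * c * w i ∧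
      (2 / σ ^ 2 - 2 * g * T / (n * σ ^ 3)) * (fderiv ℝ v y (EuclideanSpace.single i 1)) ^ 2 +
        2 * g / σ * fderiv ℝ (fun y => fderiv ℝ v y (EuclideanSpace.single i 1)) y
          (EuclideanSpace.single i 1) - 2 * c ≤ 0 := by
    intro i
    set e : EuclideanSpace ℝ (Fin n) := EuclideanSpace.single i 1 with he
    have hline : ∀ t : ℝ, HasDerivAt (fun t : ℝ => y + t • e) e t := fun t => by
      simpa using ((hasDerivAt_id t).smul_const e).const_add y
    have hlc : Continuous fun t : ℝ => y + t • e := by fun_prop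
    have hnorm : ∀ t : ℝ, ‖y + t • e - x‖ ^ 2 = ‖w‖ ^ 2 + 2 * t * w i + t ^ 2 := fun t => by
      have : y + t • e - x = w + t • e := by rw [hw]; abel
      rw [this, norm_add_sq_real, inner_smul_right, norm_smul, he,
        EuclideanSpace.inner_single_right]
      simp
      ring
    have hφ0 : ∀ᶠ t in nhds (0:ℝ), y + t • e ∈ Ω := by
      have : Tendsto (fun t : ℝ => y + t • e) (nhds 0) (nhds y) := by
        simpa using hlc.tendsto 0
      exact this.eventually (hΩopen.mem_nhds hyΩ)
    have hφd : ∀ t : ℝ, y + t • e ∈ Ω →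
        HasDerivAt (fun t : ℝ => v (y + t • e)) (fderiv ℝ v (y + t • e) e) t := fun t ht =>
      (hvd _ ht).comp_hasDerivAt t (hline t)
    have hφ1 : ∀ᶠ t in nhds (0:ℝ), lam < v (y + t • e) := by
      have : ContinuousAt (fun t : ℝ => v (y + t • e)) 0 := (hφd 0 (by simpa using hyΩ)).continuousAt
      have h3 := this.tendsto.eventually (lt_mem_nhds (a := lam) (by simpa using hvy))
      exact h3
    have hloc' : IsLocalMax
        (fun t : ℝ => G (v (y + t • e)) ^ 2 - c * (‖w‖ ^ 2 + 2 * t * w i + t ^ 2)) 0 := by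
      have h4 : IsLocalMax ((fun z => G (v z) ^ 2 - c * ‖z - x‖ ^ 2) ∘ fun t : ℝ => y + t • e) 0 := by
        refine IsLocalMax.comp_continuous ?_ hlc.continuousAt
        simpa using hloc
      have : ((fun z => G (v z) ^ 2 - c * ‖z - x‖ ^ 2) ∘ fun t : ℝ => y + t • e) =
        (fun t : ℝ => G (v (y + t • e)) ^ 2 - c * (‖w‖ ^ 2 + 2 * t * w i + t ^ 2)) := by
        funext t
        simp only [Function.comp, hnorm]
      rwa [this] at h4
    have hpoly : ∀ t : ℝ, HasDerivAt (fun t : ℝ => c * (‖w‖ ^ 2 + 2 * t * w i + t ^ 2))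
        (2 * c * (w i + t)) t := fun t => by
      have h := (((((hasDerivAt_id t).const_mul 2).mul_const (w i)).const_add (‖w‖ ^ 2)).add
        ((hasDerivAt_id t).pow 2)).const_mul c
      refine h.congr_deriv ?_
      simp
      ring
    have hso := aux_second_order _
      (fun t : ℝ => 2 * G (v (y + t • e)) / S (v (y + t • e)) * fderiv ℝ v (y + t • e) e
        - 2 * c * (w i + t))
      ((2 / σ ^ 2 - 2 * g * T / (n * σ ^ 3)) * (fderiv ℝ v y e) ^ 2 +
        2 * g / σ * fderiv ℝ (fun y => fderiv ℝ v y e) y e - 2 * c) ?_ ?_ hloc'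
    · obtain ⟨h1, h2⟩ := hso
      refine ⟨?_, h2⟩
      simp only [zero_smul, add_zero] at h1
      linarith
    · filter_upwards [hφ0, hφ1] with t ht1 ht2
      have h5 := ((hGd _ ht2).comp t (hφd t ht1)).pow 2
      refine (h5.sub (hpoly t)).congr_deriv ?_
      simp
      ring
    · have hz : y + (0:ℝ) • e = y := by simp
      have hp : HasDerivAt (fun t : ℝ => v (y + t • e)) (fderiv ℝ v y e) 0 := by
        have := hφd 0 (by rwa [hz])
        rwa [hz] at this
      have hGt : HasDerivAt (fun t : ℝ => G (v (y + t • e))) (1 / σ * fderiv ℝ v y e) 0 := by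
        refine HasDerivAt.comp (0:ℝ) (h₂ := G) ?_ hp
        rw [hz]; exact hGd _ hvy
      have hSt : HasDerivAt (fun t : ℝ => S (v (y + t • e))) (T / (n * σ) * fderiv ℝ v y e) 0 := by
        refine HasDerivAt.comp (0:ℝ) (h₂ := S) ?_ hp
        rw [hz]; exact hSd _ hvy
      have hDt : HasDerivAt (fun t : ℝ => fderiv ℝ v (y + t • e) e)
          (fderiv ℝ (fun y => fderiv ℝ v y e) y e) 0 := by
        have h6 : DifferentiableAt ℝ (fun y => fderiv ℝ v y e) y :=
          hvdd.clm_apply (differentiableAt_const e)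
        refine HasFDerivAt.comp_hasDerivAt (0:ℝ) (l := fun y => fderiv ℝ v y e) ?_ (hline 0)
        rw [hz]; exact h6.hasFDerivAt
      have hlin : HasDerivAt (fun t : ℝ => 2 * c * (w i + t)) (2 * c) 0 := by
        simpa using ((hasDerivAt_id (0:ℝ)).const_add (w i)).const_mul (2 * c)
      have h7 := (((hGt.const_mul 2).div hSt (by rw [hz]; exact hσp.ne')).mul hDt).sub hlin
      refine h7.congr_deriv ?_
      simp only [hz, Pi.div_apply]
      rw [← hg, ← hσ]
      field_simp
  have hsum : (2 / σ ^ 2 - 2 * g * T / (n * σ ^ 3)) *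
      (∑ i : Fin n, (fderiv ℝ v y (EuclideanSpace.single i 1)) ^ 2) + 2 * g / σ * T - n * (2 * c)
      ≤ 0 := by
    have h1 := Finset.sum_nonpos (s := Finset.univ) fun i _ => (key i).2
    rw [Finset.sum_sub_distrib, Finset.sum_add_distrib, ← Finset.mul_sum, ← Finset.mul_sum,
      hsol y hyΩ] at h1
    simpa using h1
  have hgrad : ∑ i : Fin n, (fderiv ℝ v y (EuclideanSpace.single i 1)) ^ 2
      = (c * σ / g) ^ 2 * ‖w‖ ^ 2 := by
    rw [EuclideanSpace.real_norm_sq_eq, Finset.mul_sum]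
    refine Finset.sum_congr rfl fun i _ => ?_
    rw [← mul_pow]
    congr 1
    have := (key i).1
    field_simp at this ⊢
    linarith
  rw [hgrad] at hsum
  have hq : 1 ≤ g * T / (n * σ) := by
    rw [le_div_iff₀ (by positivity), one_mul]
    have := hSG _ hvy
    rw [← hσ, ← hg, ← hT, ← mul_div_assoc, le_div_iff₀ (by positivity)] at this
    linarith
  set q := g * T / (n * σ) with hqd
  set ρ := c ^ 2 * ‖w‖ ^ 2 / g ^ 2 with hρ
  have hρ1 : ρ < 1 := by
    rw [hρ, div_lt_one (by positivity)]
    nlinarith [sq_nonneg ‖w‖]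
  have e : 2 * (1 - q) * ρ + 2 * n * q - 2 * n * c ≤ 0 := by
    refine le_of_eq_of_le ?_ hsum
    rw [hqd, hρ]
    field_simp
  nlinarith [mul_nonneg (sub_nonneg.2 hq) (sub_nonneg.2 (hρ1.le.trans hN))]

theorem solution_tendsto_zero_far_from_boundary
    (W : ℝ → ℝ) (hW : ContDiff ℝ 2 W) (hWnn : ∀ t, 0 ≤ W t)
    (hWconv : ConvexOn ℝ Set.univ W) (hWvan : ∀ t, W t = 0 ↔ t = 0)
    (hWint : IntegrableOn (fun u => 1 / Real.sqrt (W u)) {u : ℝ | 1 < |u|})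
    (n : ℕ) (hn : 1 ≤ n)
    (Ω : Set (EuclideanSpace ℝ (Fin n))) (hΩopen : IsOpen Ω)
    (hunbdd : ¬ BddAbove ((fun x => Metric.infDist x (frontier Ω)) '' Ω))
    (v : EuclideanSpace ℝ (Fin n) → ℝ) (hv : ContDiffOn ℝ 2 v Ω)
    (hsol : ∀ x ∈ Ω,
      (∑ i : Fin n, fderiv ℝ (fun y => fderiv ℝ v y (EuclideanSpace.single i 1)) x
          (EuclideanSpace.single i 1)) = deriv W (v x)) :
    -- pointwise bounds: d(x,∂Ω) > l(lam) forces v x ≤ lam (lam > 0), v x ≥ lam (lam < 0),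
    -- where l(lam) is the blow-up half-length for the potential W/n
    (∀ lam : ℝ, 0 < lam → ∀ x ∈ Ω,
      (∫ s in Ioi (0:ℝ), 1 / Real.sqrt (2 * (W (s + lam) / n - W lam / n)))
        < Metric.infDist x (frontier Ω) → v x ≤ lam) ∧
    (∀ lam : ℝ, lam < 0 → ∀ x ∈ Ω,
      (∫ s in Iio (0:ℝ), 1 / Real.sqrt (2 * (W (s + lam) / n - W lam / n)))
        < Metric.infDist x (frontier Ω) → lam ≤ v x) ∧
    -- v(x) → 0 as d(x, ∂Ω) → ∞ with x ∈ Ω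
    Tendsto v ((comap (fun x => Metric.infDist x (frontier Ω)) atTop) ⊓ 𝓟 Ω)
      (nhds 0) := by
  have hlow : ∀ lam : ℝ, lam < 0 → ∀ x ∈ Ω,
      (∫ s in Iio (0:ℝ), 1 / Real.sqrt (2 * (W (s + lam) / n - W lam / n)))
        < Metric.infDist x (frontier Ω) → lam ≤ v x := by
    intro lam hlam x hx hd
    have h := aux_core (fun t => W (-t)) (hW.comp contDiff_neg) (fun t => hWnn _)
      (by
        refine ⟨convex_univ, fun a _ b _ s t hs ht hst => ?_⟩
        have := hWconv.2 (mem_univ (-a)) (mem_univ (-b)) hs ht hst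
        convert this using 2
        simp only [smul_eq_mul]
        ring)
      (fun t => by rw [hWvan, neg_eq_zero])
      (by
        have h2 := ((Measure.measurePreserving_neg (volume : Measure ℝ)).integrableOn_comp_preimage
          (MeasurableEquiv.neg ℝ).measurableEmbedding).2 hWint
        have he : Neg.neg ⁻¹' {u : ℝ | 1 < |u|} = {u : ℝ | 1 < |u|} := by
          ext u; simp
        rw [he] at h2
        exact h2)
      n hn Ω hΩopen (fun z => - v z) hv.neg
      (fun z hz => by
        have h3 : ∀ i : Fin n, (fun y => fderiv ℝ (fun z => - v z) y (EuclideanSpace.single i 1))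
            = fun y => - fderiv ℝ v y (EuclideanSpace.single i 1) := fun i => by
          funext y
          rw [fderiv_fun_neg]; rfl
        rw [deriv_comp_neg, neg_neg, ← hsol z hz, ← Finset.sum_neg_distrib]
        refine Finset.sum_congr rfl fun i _ => ?_
        rw [h3 i, fderiv_fun_neg]
        rfl)
      (-lam) (by linarith) x hx
      (by
        refine lt_of_le_of_lt (le_of_eq ?_) hd
        have h4 := integral_comp_neg_Ioi (0:ℝ)
          (fun s => 1 / Real.sqrt (2 * (W (s + lam) / n - W lam / n)))
        rw [neg_zero, integral_Iic_eq_integral_Iio] at h4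
        rw [← h4]
        refine integral_congr_ae (ae_of_all _ fun s => ?_)
        simp only [neg_add_rev, neg_neg, add_comm])
    linarith
  have hup : ∀ lam : ℝ, 0 < lam → ∀ x ∈ Ω,
      (∫ s in Ioi (0:ℝ), 1 / Real.sqrt (2 * (W (s + lam) / n - W lam / n)))
        < Metric.infDist x (frontier Ω) → v x ≤ lam := fun lam hlam x hx hd =>
    aux_core W hW hWnn hWconv hWvan hWint n hn Ω hΩopen v hv hsol lam hlam x hx hd
  refine ⟨hup, hlow, ?_⟩
  rw [Metric.tendsto_nhds]
  intro ε hε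
  have hdist : ∀ C : ℝ, ∀ᶠ x in (comap (fun x => Metric.infDist x (frontier Ω)) atTop) ⊓ 𝓟 Ω,
      C < Metric.infDist x (frontier Ω) := fun C =>
    (tendsto_comap.mono_left inf_le_left).eventually (eventually_gt_atTop C)
  have hmem : ∀ᶠ x in (comap (fun x => Metric.infDist x (frontier Ω)) atTop) ⊓ 𝓟 Ω, x ∈ Ω :=
    mem_inf_of_right (mem_principal_self Ω)
  filter_upwards [hmem, hdist (∫ s in Ioi (0:ℝ), 1 / Real.sqrt (2 * (W (s + ε / 2) / n - W (ε / 2) / n))),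
    hdist (∫ s in Iio (0:ℝ), 1 / Real.sqrt (2 * (W (s + -(ε / 2)) / n - W (-(ε / 2)) / n)))] with x hx h1 h2
  have a1 := hup (ε / 2) (by linarith) x hx h1
  have a2 := hlow (-(ε / 2)) (by linarith) x hx h2
  rw [Real.dist_eq, sub_zero, abs_lt]
  constructor <;> linarith
end
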